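/- Consider the HAR-A method. Every local Lipschitz estimate H computed during the algorithm (including those rejected in the repeat loop), given by H/p! = ‖g + (σ/p!)‖d‖^{p−1} d‖/‖d‖^p where g = ∇f(y + d) − ∇Ω_p^σ(·; y)(y + d) and d is the computed minimizer from the point y with regularization σ, satisfies H ≤ L_p. Consequently, M_k ≤ H_max := max{H_0, L_p} for all k ≥ 0, and the repeat loop at any iteration executes at most ⌈log_β(H_max/H_0)⌉ times before terminating with an estimate satisfying H_{k+1} < βM_k. -/

import Mathlib

open scoped BigOperators RealInnerProductSpace

noncomputable section

/-- The `p`-th order Taylor polynomial `T_p(y; x)` of `f` at `x`, evaluated at `y`. -/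
def taylorPoly {n : ℕ} (p : ℕ) (f : EuclideanSpace ℝ (Fin n) → ℝ)
    (x y : EuclideanSpace ℝ (Fin n)) : ℝ :=
  f x + ∑ ℓ ∈ Finset.Icc 1 p,
    (1 / (Nat.factorial ℓ : ℝ)) * iteratedFDeriv ℝ ℓ f x (fun _ => y - x)

/-- The regularized Taylor polynomial `Ω_p^σ(y; x)`. -/
def omegaReg {n : ℕ} (p : ℕ) (σ : ℝ) (f : EuclideanSpace ℝ (Fin n) → ℝ)
    (x y : EuclideanSpace ℝ (Fin n)) : ℝ :=
  taylorPoly p f x y + σ / (Nat.factorial (p + 1) : ℝ) * ‖y - x‖ ^ (p + 1)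

/-- `H_max = max {H₀, L_p}`. -/
def Hmax (H0 Lp : ℝ) : ℝ := max H0 Lp

/-- `Ū = ⌈log_{(α+1)/2} (H_max / H₀)⌉`. -/
def Ubar (α H0 Lp : ℝ) : ℤ := ⌈Real.logb ((α + 1) / 2) (Hmax H0 Lp / H0)⌉

/-- `A_k = k^(p+1)`. -/
def Aseq (p k : ℕ) : ℝ := (k : ℝ) ^ (p + 1)

/-- `a_k = A_(k+1) - A_k = (k+1)^(p+1) - k^(p+1)`. -/
def aseq (p k : ℕ) : ℝ := ((k : ℝ) + 1) ^ (p + 1) - (k : ℝ) ^ (p + 1)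

/-- The constant `C_p(α, β)`. -/
def Cp (p : ℕ) (α β : ℝ) : ℝ :=
  ((p : ℝ) + 1) ^ ((3 * (p : ℝ) + 1) / 2) * ((p : ℝ) - 1) ^ ((3 * (p : ℝ) - 1) / 2)
    / (2 ^ p * (α ^ 2 - β ^ 2) ^ (((p : ℝ) - 1) / 2))

section TaylorRemainder

universe u

variable {E F : Type u} [NormedAddCommGroup E] [NormedSpace ℝ E]
  [NormedAddCommGroup F] [NormedSpace ℝ F]

theorem norm_iteratedFDeriv_fderiv_sub (m : ℕ) (f : E → F) (x y : E) :
    ‖iteratedFDeriv ℝ m (fderiv ℝ f) x - iteratedFDeriv ℝ m (fderiv ℝ f) y‖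
      = ‖iteratedFDeriv ℝ (m + 1) f x - iteratedFDeriv ℝ (m + 1) f y‖ := by
  have h := (continuousMultilinearCurryRightEquiv' ℝ m E F).symm.dist_map
    (iteratedFDeriv ℝ m (fderiv ℝ f) x) (iteratedFDeriv ℝ m (fderiv ℝ f) y)
  rw [dist_eq_norm, dist_eq_norm] at h
  simp only [iteratedFDeriv_succ_eq_comp_right]
  exact h.symm

/-- The Taylor remainder of order `m` is controlled by the Lipschitz constant of the `m`-th
derivative at the base point. -/
theorem norm_sub_taylor_le (m : ℕ) (G : E → F) (hG : ContDiff ℝ m G)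
    (L : ℝ) (y : E)
    (hL : ∀ z, ‖iteratedFDeriv ℝ m G z - iteratedFDeriv ℝ m G y‖ ≤ L * ‖z - y‖) (d : E) :
    ‖G (y + d) - ∑ l ∈ Finset.range (m + 1),
        (1 / (Nat.factorial l : ℝ)) • iteratedFDeriv ℝ l G y (fun _ => d)‖
      ≤ L / (Nat.factorial (m + 1) : ℝ) * ‖d‖ ^ (m + 1) := by
  induction m generalizing F d with
  | zero =>
    have h := hL (y + d)
    rw [← (continuousMultilinearCurryFin0 ℝ E F).norm_map, map_sub] at h
    simpa using h
  | succ m ih =>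
    have hG' : ContDiff ℝ m (fderiv ℝ G) := hG.fderiv_right (by norm_cast)
    have hdiff : Differentiable ℝ G := hG.differentiable (by simp)
    have hrem := ih (fderiv ℝ G) hG' fun z =>
      (norm_iteratedFDeriv_fderiv_sub m G z y).le.trans (hL z)
    set c : ℕ → F := fun l => iteratedFDeriv ℝ l G y (fun _ => d) with hc
    set φ : ℝ → F := fun t => G (y + t • d) - ∑ l ∈ Finset.range (m + 1 + 1),
      (t ^ l / (Nat.factorial l : ℝ)) • c l with hφ
    set φ' : ℝ → F := fun t => fderiv ℝ G (y + t • d) d - ∑ l ∈ Finset.range (m + 1),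
      (t ^ l / (Nat.factorial l : ℝ)) • c (l + 1) with hφ'
    have hderiv : ∀ t, HasDerivAt φ (φ' t) t := by
      intro t
      have h1 : HasDerivAt (fun t : ℝ => G (y + t • d)) (fderiv ℝ G (y + t • d) d) t := by
        have h2 : HasDerivAt (fun t : ℝ => y + t • d) d t := by
          simpa using ((hasDerivAt_id t).smul_const d).const_add y
        exact (hdiff _).hasFDerivAt.comp_hasDerivAt t h2
      refine h1.sub ?_
      simp only [Finset.sum_range_succ' _ (m + 1), pow_zero]
      refine (HasDerivAt.fun_sum fun l _ => ?_).add_const _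
      refine HasDerivAt.smul_const ?_ _
      refine ((hasDerivAt_pow (l + 1) t).div_const _).congr_deriv ?_
      rw [Nat.factorial_succ]
      push_cast
      have : (Nat.factorial l : ℝ) ≠ 0 := by positivity
      field_simp
    have hB : ∀ t : ℝ, HasDerivAt
        (fun t : ℝ => L / (Nat.factorial (m + 1 + 1) : ℝ) * ‖d‖ ^ (m + 1 + 1) * t ^ (m + 1 + 1))
        (L / (Nat.factorial (m + 1) : ℝ) * ‖d‖ ^ (m + 1 + 1) * t ^ (m + 1)) t := by
      intro t
      refine ((hasDerivAt_pow (m + 1 + 1) t).const_mul _).congr_deriv ?_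
      rw [Nat.factorial_succ (m + 1), Nat.add_sub_cancel]
      push_cast
      have : (Nat.factorial (m + 1) : ℝ) ≠ 0 := by positivity
      have : (m : ℝ) + 1 + 1 ≠ 0 := by positivity
      field_simp
    have hbound : ∀ t ∈ Set.Ico (0 : ℝ) 1,
        ‖φ' t‖ ≤ L / (Nat.factorial (m + 1) : ℝ) * ‖d‖ ^ (m + 1 + 1) * t ^ (m + 1) := by
      intro t ht
      have heq : φ' t = (fderiv ℝ G (y + t • d) - ∑ l ∈ Finset.range (m + 1),
          (1 / (Nat.factorial l : ℝ)) • iteratedFDeriv ℝ l (fderiv ℝ G) y (fun _ => t • d)) d := by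
        rw [sub_apply, sum_apply]
        refine congrArg _ (Finset.sum_congr rfl fun l _ => ?_)
        have hsmul := (iteratedFDeriv ℝ l (fderiv ℝ G) y).map_smul_univ (fun _ => t) (fun _ => d)
        rw [hsmul, hc]
        simp only [iteratedFDeriv_succ_apply_right, Finset.prod_const, Finset.card_univ,
          Fintype.card_fin, smul_apply, smul_smul]
        rw [div_mul_eq_mul_div, one_mul]
        rfl
      rw [heq]
      refine (ContinuousLinearMap.le_opNorm _ _).trans ?_
      refine (mul_le_mul_of_nonneg_right (hrem (t • d)) (norm_nonneg d)).trans (le_of_eq ?_)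
      rw [norm_smul, Real.norm_of_nonneg ht.1]
      ring
    have h0 : ‖φ 0‖ ≤
        L / (Nat.factorial (m + 1 + 1) : ℝ) * ‖d‖ ^ (m + 1 + 1) * (0 : ℝ) ^ (m + 1 + 1) := by
      simp [hφ, hc, Finset.sum_range_succ']
    have := image_norm_le_of_norm_deriv_right_le_deriv_boundary (a := 0) (b := 1)
      (fun t _ => (hderiv t).continuousAt.continuousWithinAt)
      (fun t _ => (hderiv t).hasDerivWithinAt) h0 hB hbound (Set.right_mem_Icc.2 zero_le_one)
    simpa [hφ, hc] using this

theorem iteratedFDeriv_succ_update_const (m : ℕ) (f : E → F) (hf : ContDiff ℝ (m + 1 : ℕ) f)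
    (x u h : E) (i : Fin (m + 1)) :
    iteratedFDeriv ℝ (m + 1) f x (Function.update (fun _ => u) i h)
      = iteratedFDeriv ℝ m (fderiv ℝ f) x (fun _ => u) h := by
  induction m generalizing F with
  | zero =>
    rw [Fin.eq_zero i, ← Fin.last_zero, iteratedFDeriv_succ_apply_right, Function.update_self]
    rw [iteratedFDeriv_zero_apply, iteratedFDeriv_zero_apply]
  | succ m ih =>
    rw [iteratedFDeriv_succ_apply_right]
    induction i using Fin.lastCases with
    | last =>
      rw [Fin.init_update_last, Function.update_self]
      rfl
    | cast i =>
      have hf' : ContDiff ℝ (m + 1 : ℕ) (fderiv ℝ f) := hf.fderiv_right (by norm_cast)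
      let e : (E →L[ℝ] E →L[ℝ] F) ≃L[ℝ] (E →L[ℝ] E →L[ℝ] F) :=
        (ContinuousLinearMap.flipₗᵢ ℝ E E F).toContinuousLinearEquiv
      have hflip : fderiv ℝ (fderiv ℝ f) = e ∘ fderiv ℝ (fderiv ℝ f) := by
        ext z v w
        exact (hf.contDiffAt.isSymmSndFDerivAt (x := z)
          (by simp only [minSmoothness_of_isRCLikeNormedField]; norm_cast; omega)) v w
      have hcomm : iteratedFDeriv ℝ m (fderiv ℝ (fderiv ℝ f)) x (fun _ => u)
          = e (iteratedFDeriv ℝ m (fderiv ℝ (fderiv ℝ f)) x (fun _ => u)) := by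
        conv_lhs => rw [hflip]
        exact DFunLike.congr_fun (ContinuousLinearEquiv.iteratedFDeriv_comp_left (𝕜 := ℝ)
          (F := E →L[ℝ] E →L[ℝ] F) (G := E →L[ℝ] E →L[ℝ] F) (f := fderiv ℝ (fderiv ℝ f))
          (x := x) e) (fun _ => u)
      rw [Fin.init_update_castSucc, Function.update_of_ne (Fin.castSucc_lt_last i).ne']
      have h1 := ih (fderiv ℝ f) hf' i
      refine (DFunLike.congr_fun h1 u).trans ?_
      rw [iteratedFDeriv_succ_apply_right, hcomm]
      rfl

theorem hasFDerivAt_iteratedFDeriv_diag (m : ℕ) (f : E → F) (hf : ContDiff ℝ (m + 1 : ℕ) f)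
    (x z : E) :
    HasFDerivAt (fun z => iteratedFDeriv ℝ (m + 1) f x (fun _ => z - x))
      (((m : ℝ) + 1) • iteratedFDeriv ℝ m (fderiv ℝ f) x (fun _ => z - x)) z := by
  have h1 : HasFDerivAt (fun z : E => (fun _ : Fin (m + 1) => z - x))
      (ContinuousLinearMap.pi fun _ => ContinuousLinearMap.id ℝ E) z :=
    hasFDerivAt_pi.2 fun _ => (hasFDerivAt_id z).sub_const x
  have h2 := ((iteratedFDeriv ℝ (m + 1) f x).hasFDerivAt (fun _ => z - x)).comp z h1
  refine h2.congr_fderiv ?_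
  ext h
  simp [ContinuousMultilinearMap.linearDeriv_apply, iteratedFDeriv_succ_update_const m f hf,
    ← Nat.cast_smul_eq_nsmul ℝ]

end TaylorRemainder

theorem hasFDerivAt_norm_pow {E : Type*} [NormedAddCommGroup E] [InnerProductSpace ℝ E]
    (m : ℕ) (x : E) :
    HasFDerivAt (fun z : E => ‖z‖ ^ (m + 2)) (((m : ℝ) + 2) • ‖x‖ ^ m • innerSL ℝ x) x := by
  have h := hasFDerivAt_norm_rpow x (p := (m : ℝ) + 2) (by linarith [(Nat.cast_nonneg m : (0:ℝ) ≤ m)])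
  simpa [smul_smul, ← Real.rpow_natCast] using h

theorem hasFDerivAt_taylorPoly {n : ℕ} (m : ℕ) (f : EuclideanSpace ℝ (Fin n) → ℝ)
    (hf : ContDiff ℝ (m + 1 : ℕ) f) (x z : EuclideanSpace ℝ (Fin n)) :
    HasFDerivAt (taylorPoly (m + 1) f x)
      (∑ l ∈ Finset.range (m + 1),
        (1 / (Nat.factorial l : ℝ)) • iteratedFDeriv ℝ l (fderiv ℝ f) x (fun _ => z - x)) z := by
  have key : taylorPoly (m + 1) f x = fun y => f x + ∑ l ∈ Finset.range (m + 1),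
      (1 / (Nat.factorial (l + 1) : ℝ)) * iteratedFDeriv ℝ (l + 1) f x (fun _ => y - x) := by
    ext y
    rw [taylorPoly, Finset.range_eq_Ico, Finset.sum_Ico_add' (fun l => (1 / (Nat.factorial l : ℝ)) *
      iteratedFDeriv ℝ l f x (fun _ => y - x)) 0 (m + 1) 1]
    rfl
  rw [key]
  refine (HasFDerivAt.fun_sum fun l hl => ?_).const_add _
  have hl' : l + 1 ≤ m + 1 := by simpa using hl
  have := (hasFDerivAt_iteratedFDeriv_diag l f (hf.of_le (by exact_mod_cast hl')) x z).const_mul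
    (1 / (Nat.factorial (l + 1) : ℝ))
  refine this.congr_fderiv ?_
  rw [smul_smul]
  congr 1
  rw [Nat.factorial_succ]
  push_cast
  have : (Nat.factorial l : ℝ) ≠ 0 := by positivity
  field_simp

theorem hasFDerivAt_omegaReg {n : ℕ} (m : ℕ) (σ : ℝ) (f : EuclideanSpace ℝ (Fin n) → ℝ)
    (hf : ContDiff ℝ (m + 1 : ℕ) f) (y d : EuclideanSpace ℝ (Fin n)) :
    HasFDerivAt (omegaReg (m + 1) σ f y)
      ((∑ l ∈ Finset.range (m + 1),
        (1 / (Nat.factorial l : ℝ)) • iteratedFDeriv ℝ l (fderiv ℝ f) y (fun _ => d))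
        + innerSL ℝ (((σ / (Nat.factorial (m + 1) : ℝ)) * ‖d‖ ^ m) • d)) (y + d) := by
  have h1 := hasFDerivAt_taylorPoly m f hf y (y + d)
  have h2 : HasFDerivAt (fun z : EuclideanSpace ℝ (Fin n) => ‖z - y‖ ^ (m + 2))
      (((m : ℝ) + 2) • ‖d‖ ^ m • innerSL ℝ d) (y + d) := by
    have := (hasFDerivAt_norm_pow m ((y + d) - y)).comp (y + d)
      ((hasFDerivAt_id (y + d)).sub_const y)
    rw [add_sub_cancel_left] at this
    exact this
  have h3 := h1.add (h2.const_mul (σ / (Nat.factorial (m + 1 + 1) : ℝ)))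
  refine h3.congr_fderiv ?_
  rw [add_sub_cancel_left, map_smul, smul_smul, smul_smul]
  congr 2
  rw [Nat.factorial_succ (m + 1)]
  push_cast
  have : (Nat.factorial (m + 1) : ℝ) ≠ 0 := by positivity
  have : (m : ℝ) + 1 + 1 ≠ 0 := by positivity
  field_simp
  ring

theorem norm_gradient_sub_gradient_omegaReg_add_le {n : ℕ} (m : ℕ) (σ L : ℝ)
    (f : EuclideanSpace ℝ (Fin n) → ℝ) (hf : ContDiff ℝ (m + 1 : ℕ) f)
    (y d : EuclideanSpace ℝ (Fin n))
    (hL : ∀ z, ‖iteratedFDeriv ℝ (m + 1) f z - iteratedFDeriv ℝ (m + 1) f y‖ ≤ L * ‖z - y‖) :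
    ‖gradient f (y + d) - gradient (omegaReg (m + 1) σ f y) (y + d)
        + ((σ / (Nat.factorial (m + 1) : ℝ)) * ‖d‖ ^ m) • d‖
      ≤ L / (Nat.factorial (m + 1) : ℝ) * ‖d‖ ^ (m + 1) := by
  have hf' : ContDiff ℝ m (fderiv ℝ f) := hf.fderiv_right (by norm_cast)
  refine le_trans (le_of_eq ?_) (norm_sub_taylor_le m (fderiv ℝ f) hf' L y
    (fun z => (norm_iteratedFDeriv_fderiv_sub m f z y).le.trans (hL z)) d)
  rw [← (InnerProductSpace.toDual ℝ (EuclideanSpace ℝ (Fin n))).norm_map]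
  congr 1
  rw [map_add, map_sub, gradient, gradient, LinearIsometryEquiv.apply_symm_apply,
    LinearIsometryEquiv.apply_symm_apply, (hasFDerivAt_omegaReg m σ f hf y d).fderiv]
  ext h
  simp
  ring

theorem HARA_Lipschitz_estimates_bounded
    {n : ℕ} (p : ℕ) (hp : 2 ≤ p)
    (f : EuclideanSpace ℝ (Fin n) → ℝ) (Lp : ℝ)
    (hf : ContDiff ℝ p f)
    (hLip : ∀ x y : EuclideanSpace ℝ (Fin n),
      ‖iteratedFDeriv ℝ p f x - iteratedFDeriv ℝ p f y‖ ≤ Lp * ‖x - y‖)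
    (domψ : Set (EuclideanSpace ℝ (Fin n))) (ψ : EuclideanSpace ℝ (Fin n) → ℝ)
    (hdom_ne : domψ.Nonempty) (hdom_closed : IsClosed domψ) (hdom_conv : Convex ℝ domψ)
    (hψconv : ConvexOn ℝ domψ ψ) (hψlsc : LowerSemicontinuousOn ψ domψ)
    (xstar : EuclideanSpace ℝ (Fin n)) (hstar : xstar ∈ domψ)
    (hminF : ∀ z ∈ domψ, f xstar + ψ xstar ≤ f z + ψ z)
    (α : ℝ) (hα : 1 < α)
    (x v y s : ℕ → EuclideanSpace ℝ (Fin n)) (M H : ℕ → ℝ)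
    (d g : ℕ → EuclideanSpace ℝ (Fin n))
    (J : ℕ → ℕ) (MT HT : ℕ → ℕ → ℝ) (DT GT : ℕ → ℕ → EuclideanSpace ℝ (Fin n))
    (hx0 : x 0 ∈ domψ) (hv0 : v 0 = x 0) (hs0 : s 0 = 0)
    (hH0 : 0 < H 0) (hM0 : M 0 = H 0)
    (hy : ∀ k, y k = (Aseq p k / Aseq p (k + 1)) • x k + (aseq p k / Aseq p (k + 1)) • v k)
    (hMT0 : ∀ k, MT k 0 = M k)
    (hDTmem : ∀ k j, y k + DT k j ∈ domψ)
    (hDTmin : ∀ k j, ∀ z ∈ domψ,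
      omegaReg p (α * MT k j) f (y k) (y k + DT k j) + ψ (y k + DT k j)
        ≤ omegaReg p (α * MT k j) f (y k) z + ψ z)
    (hDTne : ∀ k j, DT k j ≠ 0)
    (hGT : ∀ k j, GT k j = gradient f (y k + DT k j)
      - gradient (fun z => omegaReg p (α * MT k j) f (y k) z) (y k + DT k j))
    (hHT : ∀ k j, HT k j = (Nat.factorial p : ℝ)
      * ‖GT k j + ((α * MT k j / (Nat.factorial p : ℝ)) * ‖DT k j‖ ^ (p - 1)) • DT k j‖
      / ‖DT k j‖ ^ p)
    (hreject : ∀ k j, j < J k → ((α + 1) / 2) * MT k j ≤ HT k j)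
    (hMTstep : ∀ k j, j < J k → MT k (j + 1) = HT k j)
    (haccept : ∀ k, HT k (J k) < ((α + 1) / 2) * MT k (J k))
    (hd : ∀ k, d k = DT k (J k))
    (hg : ∀ k, g (k + 1) = GT k (J k))
    (hHdef : ∀ k, H (k + 1) = HT k (J k))
    (hM : ∀ k, M (k + 1) = max (MT k (J k)) (H (k + 1)))
    (hx : ∀ k, x (k + 1) = y k + d k)
    (hs : ∀ k, s (k + 1) = s k + aseq p k • g (k + 1))
    (hv : ∀ k, (s (k + 1) = 0 → v (k + 1) = x 0) ∧
      (s (k + 1) ≠ 0 → v (k + 1) = x 0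
        - (((((p : ℝ) + 1) * Cp p α ((α + 1) / 2) * M (k + 1)) ^ (-((1 : ℝ) / (p : ℝ)))
            * ‖s (k + 1)‖ ^ (-(((p : ℝ) - 1) / (p : ℝ)))) • s (k + 1)))) :
    (∀ k j, HT k j ≤ Lp) ∧
    (∀ k, M k ≤ Hmax (H 0) Lp) ∧
    (∀ k, (J k : ℤ) ≤ Ubar α (H 0) Lp) := by
  obtain ⟨m, rfl⟩ : ∃ m, p = m + 1 := ⟨p - 1, by omega⟩
  have hHTle : ∀ k j, HT k j ≤ Lp := by
    intro k j
    have hdpos : 0 < ‖DT k j‖ ^ (m + 1) := pow_pos (norm_pos_iff.2 (hDTne k j)) _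
    have hfac : (0 : ℝ) < Nat.factorial (m + 1) := by positivity
    have h := norm_gradient_sub_gradient_omegaReg_add_le m (α * MT k j) Lp f hf (y k) (DT k j)
      fun z => hLip z (y k)
    rw [hHT, hGT, div_le_iff₀ hdpos, Nat.add_sub_cancel]
    refine (mul_le_mul_of_nonneg_left h hfac.le).trans (le_of_eq ?_)
    field_simp
  set β := (α + 1) / 2 with hβ
  have hβ1 : 1 < β := by rw [hβ]; linarith
  have hloop : ∀ k, 0 < M k → M k ≤ Hmax (H 0) Lp →
      ∀ j, j ≤ J k → β ^ j * M k ≤ MT k j ∧ MT k j ≤ Hmax (H 0) Lp := by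
    intro k _ hMle j
    induction j with
    | zero => intro _; simp [hMT0, hMle]
    | succ j ih =>
      intro hj
      obtain ⟨h1, _⟩ := ih (by omega)
      rw [hMTstep k j hj]
      refine ⟨?_, (hHTle k j).trans (le_max_right _ _)⟩
      calc β ^ (j + 1) * M k = β * (β ^ j * M k) := by ring
        _ ≤ β * MT k j := by gcongr
        _ ≤ HT k j := hreject k j hj
  have hMbounds : ∀ k, H 0 ≤ M k ∧ M k ≤ Hmax (H 0) Lp := by
    intro k
    induction k with
    | zero => exact ⟨hM0.ge, hM0.le.trans (le_max_left _ _)⟩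
    | succ k ih =>
      have hpos : 0 < M k := hH0.trans_le ih.1
      obtain ⟨h1, h2⟩ := hloop k hpos ih.2 (J k) le_rfl
      rw [hM, hHdef]
      refine ⟨?_, max_le h2 ((hHTle k _).trans (le_max_right _ _))⟩
      exact ih.1.trans ((le_mul_of_one_le_left hpos.le (one_le_pow₀ hβ1.le)).trans
        (h1.trans (le_max_left _ _)))
  refine ⟨hHTle, fun k => (hMbounds k).2, fun k => ?_⟩
  obtain ⟨hlow, hup⟩ := hMbounds k
  obtain ⟨h1, h2⟩ := hloop k (hH0.trans_le hlow) hup (J k) le_rfl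
  have hHmax : 0 < Hmax (H 0) Lp := hH0.trans_le (le_max_left _ _)
  have hJ : (J k : ℝ) ≤ Real.logb β (Hmax (H 0) Lp / H 0) := by
    rw [Real.le_logb_iff_rpow_le hβ1 (div_pos hHmax hH0), Real.rpow_natCast, le_div_iff₀ hH0]
    exact (mul_le_mul_of_nonneg_left hlow (by positivity)).trans (h1.trans h2)
  have hceil : ((J k : ℤ) : ℝ) ≤ (⌈Real.logb β (Hmax (H 0) Lp / H 0)⌉ : ℝ) := by
    exact_mod_cast hJ.trans (Int.le_ceil _)
  exact_mod_cast hceil
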